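/- arXiv:1211.6083 — 2 statements merged into one kernel-verified Lean document; each statement's English description precedes it below -/
import Mathlib

section
/- Let d ∈ {2,3}, Λ > 0, let u : ℝᵈ → ℝᵈ be smooth, I^d-periodic and divergence-free, and let Q : ℝᵈ → ℝ^{d×d} be smooth, I^d-periodic and symmetric-matrix valued. Then (with summation over repeated indices) ∫_{I^d} (u·∇)Q : ΔQ dx = − ∫_{I^d} ∂_i Q_{jℓ} ∂_k Q_{ℓj} ∂_k u_i dx; this is the cancellation of the transport term against the distortion stress in the energy balance. -/
open Matrix MeasureTheory

attribute [local instance] Matrix.normedAddCommGroup Matrix.normedSpace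

noncomputable section

/-- The `m`-th partial derivative of a map defined on `ℝ^d`. -/
noncomputable def pderiv' {d : ℕ} {M : Type*} [NormedAddCommGroup M] [NormedSpace ℝ M]
    (m : Fin d) (F : (Fin d → ℝ) → M) (x : Fin d → ℝ) : M :=
  fderiv ℝ F x (Pi.single m 1)

/-- The Laplacian `Δ = Σ_m ∂_m ∂_m` of a map defined on `ℝ^d`. -/
noncomputable def lap' {d : ℕ} {M : Type*} [NormedAddCommGroup M] [NormedSpace ℝ M]
    (F : (Fin d → ℝ) → M) (x : Fin d → ℝ) : M :=
  ∑ m : Fin d, pderiv' m (pderiv' m F) x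

/-- The fundamental cube `I^d = [-Λπ/2, Λπ/2]^d`. -/
def cube (d : ℕ) (Λ : ℝ) : Set (Fin d → ℝ) :=
  Set.Icc (fun _ => -(Λ * Real.pi / 2)) (fun _ => Λ * Real.pi / 2)

/-- A map on `ℝ^d` is `I^d`-periodic if it is `Λπ`-periodic in each coordinate. -/
def IsCubePeriodic {d : ℕ} {M : Type*} (Λ : ℝ) (F : (Fin d → ℝ) → M) : Prop :=
  ∀ (x : Fin d → ℝ) (m : Fin d), F (x + (Λ * Real.pi) • (Pi.single m 1 : Fin d → ℝ)) = F x

/-- The integral of a partial derivative of a `C^1` periodic function vanishes. -/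
theorem integral_pderiv_eq_zero {d : ℕ} {Λ : ℝ} (hΛ : 0 < Λ) (m : Fin d)
    (f : (Fin d → ℝ) → ℝ) (hf : ContDiff ℝ 1 f) (hper : IsCubePeriodic Λ f) :
    ∫ x in cube d Λ, pderiv' m f x = 0 := by
  obtain _ | n := d
  · exact m.elim0
  have hpi : 0 < Λ * Real.pi := mul_pos hΛ Real.pi_pos
  have hc : Continuous (fderiv ℝ f) := hf.continuous_fderiv (by norm_num)
  let a : Fin (n + 1) → ℝ := fun _ => -(Λ * Real.pi / 2)
  let b : Fin (n + 1) → ℝ := fun _ => Λ * Real.pi / 2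
  have key := integral_divergence_of_hasFDerivAt_off_countable' a b
    (fun i => by simp only [a, b]; linarith)
    (fun i => if i = m then f else 0)
    (fun i x => if i = m then fderiv ℝ f x else 0) ∅ Set.countable_empty
    (fun i => by
      by_cases h : i = m
      · simpa [h] using hf.continuous.continuousOn
      · simp only [h, if_false]; exact continuousOn_const)
    (fun x _ i => by
      by_cases h : i = m
      · simpa [h] using (hf.differentiable (by norm_num) x).hasFDerivAt
      · simp only [h, if_false]; exact hasFDerivAt_const (0 : ℝ) x)
    (by
      apply Continuous.integrableOn_Icc
      refine continuous_finsetSum _ fun i _ => ?_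
      by_cases h : i = m
      · simpa [h] using hc.clm_apply continuous_const
      · simpa [h] using continuous_const)
  have e1 : ∀ x, ∑ i : Fin (n+1), (if i = m then fderiv ℝ f x else 0) (Pi.single i 1)
      = pderiv' m f x := by
    intro x
    rw [Finset.sum_eq_single m]
    · simp [pderiv']
    · intro i _ h; simp [h]
    · simp
  simp only [e1] at key
  change ∫ x in Set.Icc a b, pderiv' m f x = 0
  rw [key]
  refine Finset.sum_eq_zero fun i _ => ?_
  by_cases h : i = m
  · subst h
    simp only [if_true]
    rw [sub_eq_zero]
    congr 1
    ext y
    rw [← hper (Fin.insertNth i (a i) y) i]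
    congr 1
    ext k
    refine Fin.succAboveCases i ?_ (fun k => ?_) k
    · simp [a, b]; ring
    · simp
  · simp [h]

theorem pderiv_periodic {d : ℕ} {Λ : ℝ} (m : Fin d) {f : (Fin d → ℝ) → ℝ}
    (hper : IsCubePeriodic Λ f) : IsCubePeriodic Λ (pderiv' m f) := by
  intro x k
  unfold pderiv'
  rw [← fderiv_comp_add_right]
  congr 2
  ext y
  exact hper y k

theorem pderiv_contDiff {d : ℕ} {M : Type*} [NormedAddCommGroup M] [NormedSpace ℝ M]
    (m : Fin d) {f : (Fin d → ℝ) → M}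
    (hf : ContDiff ℝ (⊤ : ℕ∞) f) : ContDiff ℝ (⊤ : ℕ∞) (pderiv' m f) := by
  have : ContDiff ℝ (⊤ : ℕ∞) (fderiv ℝ f) := hf.fderiv_right (by simp)
  exact this.clm_apply contDiff_const

theorem pderiv_mul {d : ℕ} (m : Fin d) {f g : (Fin d → ℝ) → ℝ}
    (hf : ContDiff ℝ (⊤ : ℕ∞) f) (hg : ContDiff ℝ (⊤ : ℕ∞) g) (x : Fin d → ℝ) :
    pderiv' m (fun y => f y * g y) x = pderiv' m f x * g x + f x * pderiv' m g x := by
  unfold pderiv'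
  rw [fderiv_fun_mul (hf.differentiable (by simp) x) (hg.differentiable (by simp) x)]
  simp; ring

theorem pderiv_comm {d : ℕ} (m k : Fin d) {f : (Fin d → ℝ) → ℝ}
    (hf : ContDiff ℝ (⊤ : ℕ∞) f) (x : Fin d → ℝ) :
    pderiv' m (pderiv' k f) x = pderiv' k (pderiv' m f) x := by
  have hd : DifferentiableAt ℝ (fderiv ℝ f) x :=
    ((hf.fderiv_right (m := (⊤ : ℕ∞)) (by simp)).differentiable (by simp)) x
  have e : ∀ i j : Fin d, pderiv' i (pderiv' j f) x
      = fderiv ℝ (fderiv ℝ f) x (Pi.single i 1) (Pi.single j 1) := by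
    intro i j
    unfold pderiv'
    rw [fderiv_clm_apply hd (differentiableAt_const _)]
    simp
  rw [e, e]
  exact ((contDiff_infty.1 hf 2).contDiffAt.isSymmSndFDerivAt (by simp)).eq _ _

theorem integral_mul_pderiv {d : ℕ} {Λ : ℝ} (hΛ : 0 < Λ) (m : Fin d)
    {f g : (Fin d → ℝ) → ℝ}
    (hf : ContDiff ℝ (⊤ : ℕ∞) f) (hg : ContDiff ℝ (⊤ : ℕ∞) g)
    (pf : IsCubePeriodic Λ f) (pg : IsCubePeriodic Λ g) :
    ∫ x in cube d Λ, (pderiv' m f x * g x + f x * pderiv' m g x) = 0 := by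
  simp only [← pderiv_mul m hf hg]
  refine integral_pderiv_eq_zero hΛ m _ ((hf.mul hg).of_le (by simp)) fun x k => ?_
  simp only [pf x k, pg x k]

theorem contDiff_integrable {d : ℕ} {Λ : ℝ} {f : (Fin d → ℝ) → ℝ}
    (hf : ContDiff ℝ (⊤ : ℕ∞) f) : IntegrableOn f (cube d Λ) :=
  hf.continuous.integrableOn_Icc

/-- The scalar identity. -/
theorem scalar_identity {d : ℕ} {Λ : ℝ} (hΛ : 0 < Λ)
    (v : Fin d → (Fin d → ℝ) → ℝ) (hv : ∀ i, ContDiff ℝ (⊤ : ℕ∞) (v i))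
    (pv : ∀ i, IsCubePeriodic Λ (v i))
    (hdiv : ∀ x, ∑ i, pderiv' i (v i) x = 0)
    (q : (Fin d → ℝ) → ℝ) (hq : ContDiff ℝ (⊤ : ℕ∞) q) (pq : IsCubePeriodic Λ q) :
    ∫ x in cube d Λ, ((∑ i, ∑ k, v i x * pderiv' i q x * pderiv' k (pderiv' k q) x)
      + ∑ i, ∑ k, pderiv' i q x * pderiv' k q x * pderiv' k (v i) x) = 0 := by
  have h1 := fun i => pderiv_contDiff i hq
  have p1 := fun i => pderiv_periodic i pq
  have A : ∀ i k, ∫ x in cube d Λ,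
      (pderiv' k (fun y => v i y * pderiv' i q y) x * pderiv' k q x
        + (v i x * pderiv' i q x) * pderiv' k (pderiv' k q) x) = 0 := fun i k =>
    integral_mul_pderiv hΛ k ((hv i).mul (h1 i)) (h1 k)
      (fun x m => by simp only [pv i x m, p1 i x m]) (p1 k)
  have B : ∀ i k, ∫ x in cube d Λ,
      (pderiv' i (v i) x * (pderiv' k q x * pderiv' k q x)
        + v i x * pderiv' i (fun y => pderiv' k q y * pderiv' k q y) x) = 0 := fun i k =>
    integral_mul_pderiv hΛ i (hv i) ((h1 k).mul (h1 k)) (pv i)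
      (fun x m => by simp only [p1 k x m])
  have cA : ∀ i k, IntegrableOn (fun x =>
      (pderiv' k (fun y => v i y * pderiv' i q y) x * pderiv' k q x
        + (v i x * pderiv' i q x) * pderiv' k (pderiv' k q) x)) (cube d Λ) := fun i k =>
    contDiff_integrable (((pderiv_contDiff k ((hv i).mul (h1 i))).mul (h1 k)).add
      (((hv i).mul (h1 i)).mul (pderiv_contDiff k (h1 k))))
  have cB : ∀ i k, IntegrableOn (fun x =>
      (pderiv' i (v i) x * (pderiv' k q x * pderiv' k q x)
        + v i x * pderiv' i (fun y => pderiv' k q y * pderiv' k q y) x)) (cube d Λ) := fun i k =>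
    contDiff_integrable (((pderiv_contDiff i (hv i)).mul ((h1 k).mul (h1 k))).add
      ((hv i).mul (pderiv_contDiff i ((h1 k).mul (h1 k)))))
  have cAB : ∀ i k, IntegrableOn (fun x =>
      ((pderiv' k (fun y => v i y * pderiv' i q y) x * pderiv' k q x
        + (v i x * pderiv' i q x) * pderiv' k (pderiv' k q) x)
       - (1/2 : ℝ) * (pderiv' i (v i) x * (pderiv' k q x * pderiv' k q x)
        + v i x * pderiv' i (fun y => pderiv' k q y * pderiv' k q y) x))) (cube d Λ) := fun i k =>
    (cA i k).sub ((cB i k).const_mul _)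
  have tot : ∫ x in cube d Λ, ∑ i, ∑ k,
      ((pderiv' k (fun y => v i y * pderiv' i q y) x * pderiv' k q x
        + (v i x * pderiv' i q x) * pderiv' k (pderiv' k q) x)
       - (1/2 : ℝ) * (pderiv' i (v i) x * (pderiv' k q x * pderiv' k q x)
        + v i x * pderiv' i (fun y => pderiv' k q y * pderiv' k q y) x)) = 0 := by
    rw [integral_finsetSum _ fun i _ => integrable_finsetSum _ fun k _ =>
      cAB i k]
    refine Finset.sum_eq_zero fun i _ => ?_
    rw [integral_finsetSum _ fun k _ => cAB i k]
    refine Finset.sum_eq_zero fun k _ => ?_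
    rw [integral_sub (cA i k) ((cB i k).const_mul _), integral_const_mul, A, B]
    simp
  rw [← tot]
  congr 1
  ext x
  have hz : ∑ i, ∑ k, pderiv' i (v i) x * (pderiv' k q x * pderiv' k q x) = 0 := by
    simp only [← Finset.mul_sum]
    rw [← Finset.sum_mul, hdiv, zero_mul]
  have hz' : (1/2 : ℝ) * ∑ i, ∑ k, pderiv' i (v i) x * (pderiv' k q x * pderiv' k q x) = 0 := by
    rw [hz, mul_zero]
  rw [← sub_zero (_ + _), ← hz']
  simp only [Finset.mul_sum, ← Finset.sum_add_distrib, ← Finset.sum_sub_distrib]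
  refine Finset.sum_congr rfl fun i _ => Finset.sum_congr rfl fun k _ => ?_
  rw [pderiv_mul k (hv i) (h1 i), pderiv_mul i (h1 k) (h1 k), pderiv_comm k i hq]
  ring

theorem pderiv_vec_apply {d : ℕ} (m : Fin d) {u : (Fin d → ℝ) → (Fin d → ℝ)}
    (hu : Differentiable ℝ u) (x : Fin d → ℝ) (i : Fin d) :
    pderiv' m u x i = pderiv' m (fun y => u y i) x := by
  have := ((ContinuousLinearMap.proj (R := ℝ) (φ := fun _ : Fin d => ℝ) i).hasFDerivAt.comp x
    (hu x).hasFDerivAt).fderiv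
  unfold pderiv'
  change _ = fderiv ℝ ((ContinuousLinearMap.proj (R := ℝ) (φ := fun _ : Fin d => ℝ) i) ∘ u) x _
  rw [this]
  rfl

/-- Evaluation of a matrix entry, as a continuous linear map. -/
def entryCLM (d : ℕ) (j l : Fin d) : Matrix (Fin d) (Fin d) ℝ →L[ℝ] ℝ :=
  (ContinuousLinearMap.proj (R := ℝ) (φ := fun _ : Fin d => ℝ) l).comp
    (ContinuousLinearMap.proj (R := ℝ) (φ := fun _ : Fin d => Fin d → ℝ) j)

theorem pderiv_mat_apply {d : ℕ} (m : Fin d) {Q : (Fin d → ℝ) → Matrix (Fin d) (Fin d) ℝ}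
    (hQ : Differentiable ℝ Q) (x : Fin d → ℝ) (j l : Fin d) :
    pderiv' m Q x j l = pderiv' m (fun y => Q y j l) x := by
  have := ((entryCLM d j l).hasFDerivAt.comp x (hQ x).hasFDerivAt).fderiv
  unfold pderiv'
  change _ = fderiv ℝ ((entryCLM d j l) ∘ Q) x _
  rw [this]
  rfl

/-- For `u` smooth, `I^d`-periodic and divergence-free and `Q` smooth,
`I^d`-periodic and symmetric-matrix valued (`d ∈ {2,3}`),
`∫_{I^d} (u·∇)Q : ΔQ dx = - ∫_{I^d} ∂_i Q_{jℓ} ∂_k Q_{ℓj} ∂_k u_i dx`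
(summation over repeated indices): the cancellation of the transport term against the
distortion stress in the energy balance. -/
theorem transport_distortion_cancellation (d : ℕ) (hd : d = 2 ∨ d = 3)
    (Λ : ℝ) (hΛ : 0 < Λ)
    (u : (Fin d → ℝ) → (Fin d → ℝ)) (hu : ContDiff ℝ (⊤ : ℕ∞) u)
    (huper : IsCubePeriodic Λ u)
    (hdiv : ∀ x, ∑ i : Fin d, pderiv' i u x i = 0)
    (Q : (Fin d → ℝ) → Matrix (Fin d) (Fin d) ℝ) (hQ : ContDiff ℝ (⊤ : ℕ∞) Q)
    (hQper : IsCubePeriodic Λ Q) (hQsym : ∀ x, (Q x)ᵀ = Q x) :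
    (∫ x in cube d Λ, ((∑ i : Fin d, u x i • pderiv' i Q x)ᵀ * lap' Q x).trace)
      = - ∫ x in cube d Λ,
          ∑ i : Fin d, ∑ j : Fin d, ∑ k : Fin d, ∑ l : Fin d,
            pderiv' i Q x j l * pderiv' k Q x l j * pderiv' k u x i := by
  have du : Differentiable ℝ u := hu.differentiable (by simp)
  have dQ : Differentiable ℝ Q := hQ.differentiable (by simp)
  have dQ' : ∀ m, Differentiable ℝ (pderiv' m Q) := fun m =>
    (pderiv_contDiff m hQ).differentiable (by simp)
  have hv : ∀ i, ContDiff ℝ (⊤ : ℕ∞) (fun x => u x i) := fun i => contDiff_pi.1 hu i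
  have pv : ∀ i, IsCubePeriodic Λ (fun x => u x i) := fun i x m => congrFun (huper x m) i
  have hq : ∀ j l, ContDiff ℝ (⊤ : ℕ∞) (fun x => Q x j l) := fun j l =>
    (entryCLM d j l).contDiff.comp hQ
  have pq : ∀ j l, IsCubePeriodic Λ (fun x => Q x j l) := fun j l x m =>
    congrFun (congrFun (hQper x m) j) l
  have hdiv' : ∀ x, ∑ i, pderiv' i (fun y => u y i) x = 0 := fun x => by
    rw [← hdiv x]
    exact Finset.sum_congr rfl fun i _ => (pderiv_vec_apply i du x i).symm
  have h1 := fun i j l => pderiv_contDiff i (hq j l)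
  have S := fun j l => scalar_identity hΛ (fun i x => u x i) hv pv hdiv' _ (hq j l) (pq j l)
  have cL : ∀ j l, ContDiff ℝ (⊤ : ℕ∞) (fun x => ∑ i, ∑ k, u x i * pderiv' i (fun y => Q y j l) x
      * pderiv' k (pderiv' k (fun y => Q y j l)) x) := fun j l =>
    ContDiff.sum fun i _ => ContDiff.sum fun k _ =>
      ((hv i).mul (h1 i j l)).mul (pderiv_contDiff k (h1 k j l))
  have cR : ∀ j l, ContDiff ℝ (⊤ : ℕ∞) (fun x => ∑ i, ∑ k, pderiv' i (fun y => Q y j l) x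
      * pderiv' k (fun y => Q y j l) x * pderiv' k (fun y => u y i) x) := fun j l =>
    ContDiff.sum fun i _ => ContDiff.sum fun k _ =>
      ((h1 i j l).mul (h1 k j l)).mul (pderiv_contDiff k (hv i))
  have eL : ∀ x, ((∑ i : Fin d, u x i • pderiv' i Q x)ᵀ * lap' Q x).trace
      = ∑ j, ∑ l, ∑ i, ∑ k, u x i * pderiv' i (fun y => Q y j l) x
        * pderiv' k (pderiv' k (fun y => Q y j l)) x := by
    intro x
    have e2 : ∀ k j l, pderiv' k (pderiv' k Q) x j l
        = pderiv' k (pderiv' k (fun y => Q y j l)) x := by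
      intro k j l
      rw [pderiv_mat_apply k (dQ' k)]
      simp only [pderiv_mat_apply k dQ]
    simp only [Matrix.trace, Matrix.diag, Matrix.mul_apply, Matrix.transpose_apply, lap',
      Matrix.sum_apply, Matrix.smul_apply, smul_eq_mul, e2, pderiv_mat_apply _ dQ,
      Finset.sum_mul_sum]
    rw [Finset.sum_comm]
  have eR : ∀ x, (∑ i : Fin d, ∑ j : Fin d, ∑ k : Fin d, ∑ l : Fin d,
            pderiv' i Q x j l * pderiv' k Q x l j * pderiv' k u x i)
      = ∑ j, ∑ l, ∑ i, ∑ k, pderiv' i (fun y => Q y j l) x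
      * pderiv' k (fun y => Q y j l) x * pderiv' k (fun y => u y i) x := by
    intro x
    have hs : ∀ j l, (fun y => Q y l j) = (fun y => Q y j l) := fun j l => by
      ext y
      exact congrFun (congrFun (hQsym y) j) l
    simp only [pderiv_mat_apply _ dQ, pderiv_vec_apply _ du]
    rw [Finset.sum_comm]
    refine Finset.sum_congr rfl fun j _ => ?_
    rw [Finset.sum_comm' (t' := Finset.univ) (s' := fun _ => Finset.univ) (by simp)]
    rw [Finset.sum_comm]
    rw [Finset.sum_comm (s := Finset.univ (α := Fin d)) (t := Finset.univ (α := Fin d))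
      (f := fun l i => ∑ k, pderiv' i (fun y => Q y j l) x
      * pderiv' k (fun y => Q y j l) x * pderiv' k (fun y => u y i) x)]
    refine Finset.sum_congr rfl fun i _ => ?_
    rw [Finset.sum_comm]
    refine Finset.sum_congr rfl fun l _ => Finset.sum_congr rfl fun k _ => ?_
    rw [hs j l]
  simp only [eL, eR]
  rw [eq_neg_iff_add_eq_zero, ← integral_add]
  · simp only [← Finset.sum_add_distrib (s := Finset.univ (α := Fin d))] at S ⊢
    have cS : ∀ j l, IntegrableOn (fun x => ∑ i, ∑ k, (u x i * pderiv' i (fun y => Q y j l) x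
      * pderiv' k (pderiv' k (fun y => Q y j l)) x + pderiv' i (fun y => Q y j l) x
      * pderiv' k (fun y => Q y j l) x * pderiv' k (fun y => u y i) x)) (cube d Λ) := fun j l => by
      have := contDiff_integrable (Λ := Λ) ((cL j l).add (cR j l))
      simpa only [← Finset.sum_add_distrib] using this
    rw [integral_finsetSum _ fun j _ => integrable_finsetSum _ fun l _ => cS j l]
    refine Finset.sum_eq_zero fun j _ => ?_
    rw [integral_finsetSum _ fun l _ => cS j l]
    exact Finset.sum_eq_zero fun l _ => S j l
  · exact contDiff_integrable (ContDiff.sum fun j _ => ContDiff.sum fun l _ => cL j l)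
  · exact contDiff_integrable (ContDiff.sum fun j _ => ContDiff.sum fun l _ => cR j l)
end
end

section
/- Let d ∈ {2,3}, Λ > 0, ξ ∈ ℝ and Γ, L, θ, κ, ν > 0, and let ψ : Sym₀(d) → ℝ be continuously differentiable. Let T > 0 and let Q : ℝᵈ × (0,T) → Sym₀(d), u : ℝᵈ × (0,T) → ℝᵈ and p : ℝᵈ × (0,T) → ℝ be smooth, I^d-periodic in x, with u divergence-free, satisfying pointwise the Beris–Edwards system: ∂_t Q + (u·∇)Q − S(Q,∇u) = Γ H, and ∂_t u + (u·∇)u = ν Δu − ∇p + div(τ + σ), where H := L ΔQ − θ⟨∂ψ/∂Q (Q)⟩ + κ Q. Then the total energy E(t) := ∫_{I^d} ( ½|u|² + (L/2)|∇Q|² + θ ψ(Q) − (κ/2) tr[Q²] ) dx is differentiable on (0,T) and satisfies the dissipation identity dE/dt = − Γ ∫_{I^d} |H|² dx − ν ∫_{I^d} |∇u|² dx. -/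
open Matrix MeasureTheory

attribute [local instance] Matrix.normedAddCommGroup Matrix.normedSpace

noncomputable section

/-- Space-time `ℝ^d × ℝ` (a point is `(x, t)`). -/
abbrev SpTime (d : ℕ) := (Fin d → ℝ) × ℝ

/-- The `j`-th spatial direction in space-time. -/
def sdir (d : ℕ) (j : Fin d) : SpTime d := (Pi.single j 1, 0)

/-- The time direction in space-time. -/
def tdir (d : ℕ) : SpTime d := (0, 1)

/-- Spatial partial derivative `∂_j` of a space-time map. -/
noncomputable def spd {d : ℕ} {M : Type*} [NormedAddCommGroup M] [NormedSpace ℝ M]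
    (j : Fin d) (F : SpTime d → M) (z : SpTime d) : M :=
  fderiv ℝ F z (sdir d j)

/-- Time derivative `∂_t` of a space-time map. -/
noncomputable def tpd {d : ℕ} {M : Type*} [NormedAddCommGroup M] [NormedSpace ℝ M]
    (F : SpTime d → M) (z : SpTime d) : M :=
  fderiv ℝ F z (tdir d)

/-- Spatial Laplacian `Δ = Σ_m ∂_m ∂_m` of a space-time map. -/
noncomputable def slap {d : ℕ} {M : Type*} [NormedAddCommGroup M] [NormedSpace ℝ M]
    (F : SpTime d → M) (z : SpTime d) : M :=
  ∑ m : Fin d, spd m (spd m F) z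

/-- The velocity gradient matrix, `(∇u)_{ij} = ∂_j u_i`. -/
noncomputable def gradVel {d : ℕ} (u : SpTime d → (Fin d → ℝ)) (z : SpTime d) :
    Matrix (Fin d) (Fin d) ℝ :=
  Matrix.of fun i j => spd j u z i

/-- The skew-symmetric part `D₀ = ((∇u) - (∇u)ᵀ)/2` of the velocity gradient. -/
noncomputable def skewPart {d : ℕ} (u : SpTime d → (Fin d → ℝ)) (z : SpTime d) :
    Matrix (Fin d) (Fin d) ℝ :=
  ((1 : ℝ) / 2) • (gradVel u z - (gradVel u z)ᵀ)

/-- The symmetric part `D = ((∇u) + (∇u)ᵀ)/2` of the velocity gradient. -/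
noncomputable def symPart {d : ℕ} (u : SpTime d → (Fin d → ℝ)) (z : SpTime d) :
    Matrix (Fin d) (Fin d) ℝ :=
  ((1 : ℝ) / 2) • (gradVel u z + (gradVel u z)ᵀ)

/-- The trace-free part `⟨A⟩ = A - (tr[A]/d) I` of a matrix. -/
noncomputable def tfree {d : ℕ} (A : Matrix (Fin d) (Fin d) ℝ) : Matrix (Fin d) (Fin d) ℝ :=
  A - (A.trace / (d : ℝ)) • (1 : Matrix (Fin d) (Fin d) ℝ)

/-- A space-time map is `I^d`-periodic if it is `Λπ`-periodic in each spatial coordinate. -/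
def IsCubePeriodicST {d : ℕ} {M : Type*} (Λ : ℝ) (F : SpTime d → M) : Prop :=
  ∀ (z : SpTime d) (m : Fin d),
    F (z.1 + (Λ * Real.pi) • (Pi.single m 1 : Fin d → ℝ), z.2) = F z

/-- The molecular field `H = LΔQ − θ⟨∂ψ/∂Q(Q)⟩ + κQ`. -/
noncomputable def molecularField {d : ℕ} (L θ κ : ℝ)
    (gradψ : Matrix (Fin d) (Fin d) ℝ → Matrix (Fin d) (Fin d) ℝ)
    (Q : SpTime d → Matrix (Fin d) (Fin d) ℝ) (z : SpTime d) :
    Matrix (Fin d) (Fin d) ℝ :=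
  L • slap Q z - θ • tfree (gradψ (Q z)) + κ • Q z

/-- The tumbling term
`S(Q,∇u) = (D₀+ξD)(Q+I/d) − (Q+I/d)(D₀−ξD) − 2ξ(Q+I/d) tr[Q∇u]`. -/
noncomputable def tumbling {d : ℕ} (ξ : ℝ) (u : SpTime d → (Fin d → ℝ))
    (Q : SpTime d → Matrix (Fin d) (Fin d) ℝ) (z : SpTime d) :
    Matrix (Fin d) (Fin d) ℝ :=
  (skewPart u z + ξ • symPart u z) * (Q z + ((1 : ℝ) / d) • 1)
    - (Q z + ((1 : ℝ) / d) • 1) * (skewPart u z - ξ • symPart u z)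
    - (2 * ξ * (Q z * gradVel u z).trace) • (Q z + ((1 : ℝ) / d) • 1)

/-- The stress tensor `τ`, with
`τ_ij = −ξ(Q+I/d)_{ik}H_{kj} − ξH_{ik}(Q+I/d)_{kj} + 2ξ(Q+I/d)_{ij} tr[QH]
        − L tr[∂_i Q ∂_j Q]`. -/
noncomputable def tauStress {d : ℕ} (ξ L θ κ : ℝ)
    (gradψ : Matrix (Fin d) (Fin d) ℝ → Matrix (Fin d) (Fin d) ℝ)
    (Q : SpTime d → Matrix (Fin d) (Fin d) ℝ) (z : SpTime d) :
    Matrix (Fin d) (Fin d) ℝ :=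
  (-ξ) • ((Q z + ((1 : ℝ) / d) • 1) * molecularField L θ κ gradψ Q z)
    + (-ξ) • (molecularField L θ κ gradψ Q z * (Q z + ((1 : ℝ) / d) • 1))
    + (2 * ξ * (Q z * molecularField L θ κ gradψ Q z).trace) • (Q z + ((1 : ℝ) / d) • 1)
    - L • (Matrix.of fun i j => (spd i Q z * spd j Q z).trace)

/-- The stress tensor `σ = QH − HQ`. -/
noncomputable def sigmaStress {d : ℕ} (L θ κ : ℝ)
    (gradψ : Matrix (Fin d) (Fin d) ℝ → Matrix (Fin d) (Fin d) ℝ)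
    (Q : SpTime d → Matrix (Fin d) (Fin d) ℝ) (z : SpTime d) :
    Matrix (Fin d) (Fin d) ℝ :=
  Q z * molecularField L θ κ gradψ Q z - molecularField L θ κ gradψ Q z * Q z

lemma aux_deriv_integral {d : ℕ} (Λ : ℝ) (f : SpTime d → ℝ) (hf : ContDiff ℝ 1 f) (t : ℝ) :
    HasDerivAt (fun s : ℝ => ∫ x in cube d Λ, f (x, s)) (∫ x in cube d Λ, tpd f (x, t)) t := by
  have hK : IsCompact (cube d Λ) := isCompact_Icc
  have hcd : Continuous (tpd f) := (hf.continuous_fderiv one_ne_zero).clm_apply continuous_const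
  obtain ⟨C, hC⟩ := (hK.prod (isCompact_Icc (a := t - 1) (b := t + 1))).exists_bound_of_continuousOn
    hcd.continuousOn
  have hfin : volume (cube d Λ) < ⊤ := hK.measure_lt_top
  refine (hasDerivAt_integral_of_dominated_loc_of_deriv_le (μ := volume.restrict (cube d Λ))
    (F := fun s x => f (x, s)) (F' := fun s x => tpd f (x, s)) (bound := fun _ => C)
    (s := Set.Icc (t - 1) (t + 1)) (Icc_mem_nhds (by linarith) (by linarith)) ?_ ?_ ?_ ?_ ?_ ?_).2
  · refine Filter.Eventually.of_forall fun s => Continuous.aestronglyMeasurable ?_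
    exact hf.continuous.comp (by fun_prop)
  · exact ContinuousOn.integrableOn_compact hK (hf.continuous.comp (by fun_prop)).continuousOn
  · exact Continuous.aestronglyMeasurable (hcd.comp (by fun_prop))
  · refine (ae_restrict_iff' measurableSet_Icc).2 (Filter.Eventually.of_forall fun x hx s hs => ?_)
    exact hC (x, s) ⟨hx, hs⟩
  · exact integrableOn_const hfin.ne
  · refine Filter.Eventually.of_forall fun x s _ => ?_
    have h1 : HasFDerivAt f (fderiv ℝ f (x, s)) (x, s) :=
      (hf.differentiable one_ne_zero _).hasFDerivAt
    have h2 : HasDerivAt (fun s : ℝ => ((x, s) : SpTime d)) (tdir d) s :=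
      (hasDerivAt_const s x).prodMk (hasDerivAt_id s)
    exact h1.comp_hasDerivAt s h2

lemma aux_div_zero {n : ℕ} (Λ : ℝ) (hΛ : 0 < Λ) (F : Fin (n+1) → SpTime (n+1) → ℝ) (t : ℝ)
    (hF : ∀ m x, DifferentiableAt ℝ (F m) (x, t))
    (hper : ∀ m, IsCubePeriodicST Λ (F m))
    (hint : Continuous fun x : Fin (n+1) → ℝ => ∑ m, spd m (F m) (x, t)) :
    ∫ x in cube (n+1) Λ, ∑ m, spd m (F m) (x, t) = 0 := by
  have hd : ∀ m x, HasFDerivAt (fun x : Fin (n+1) → ℝ => F m (x, t))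
      ((fderiv ℝ (F m) (x, t)).comp (ContinuousLinearMap.inl ℝ _ ℝ)) x := by
    intro m x
    exact (hF m x).hasFDerivAt.comp x (hasFDerivAt_prodMk_left x t)
  have hpos : 0 < Λ * Real.pi := mul_pos hΛ Real.pi_pos
  have key := integral_divergence_of_hasFDerivAt_off_countable'
    (a := fun _ : Fin (n+1) => -(Λ * Real.pi / 2)) (b := fun _ => Λ * Real.pi / 2)
    (fun _ => by dsimp only; linarith)
    (fun m x => F m (x, t))
    (fun m x => (fderiv ℝ (F m) (x, t)).comp (ContinuousLinearMap.inl ℝ _ ℝ)) ∅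
    Set.countable_empty
    (fun m => (continuous_iff_continuousAt.2 fun x => (hd m x).continuousAt).continuousOn)
    (fun x _ m => hd m x)
    (hint.continuousOn.integrableOn_compact isCompact_Icc)
  refine Eq.trans key ?_
  refine Finset.sum_eq_zero fun m _ => ?_
  rw [sub_eq_zero]
  congr 1
  funext x
  symm
  rw [← hper m (_, t) m]
  congr 2
  funext k
  refine Fin.succAboveCases m ?_ (fun k => ?_) k
  · simp; ring
  · simp

lemma aux_per_fderiv {d : ℕ} {M : Type*} [NormedAddCommGroup M] [NormedSpace ℝ M] {Λ : ℝ}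
    {F : SpTime d → M} (h : IsCubePeriodicST Λ F) (v : SpTime d) :
    IsCubePeriodicST Λ (fun z => fderiv ℝ F z v) := by
  intro z m
  have h2 : F = fun w => F (w + ((Λ * Real.pi) • (Pi.single m 1 : Fin d → ℝ), 0)) := by
    funext w
    rw [← h w m]
    congr 1
    ext <;> simp
  conv_rhs => rw [h2]
  dsimp only
  rw [fderiv_comp_add_right]
  congr 2
  ext <;> simp

lemma aux_comm {d : ℕ} {M : Type*} [NormedAddCommGroup M] [NormedSpace ℝ M]
    {F : SpTime d → M} (h : ContDiff ℝ (⊤ : ℕ∞) F) (v w z : SpTime d) :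
    fderiv ℝ (fun y => fderiv ℝ F y v) z w = fderiv ℝ (fun y => fderiv ℝ F y w) z v := by
  have hs : IsSymmSndFDerivAt ℝ F z :=
    h.contDiffAt.isSymmSndFDerivAt (by
      simp only [minSmoothness_of_isRCLikeNormedField]
      exact WithTop.coe_le_coe.2 (le_top : (2 : ℕ∞) ≤ ⊤))
  have hdf : DifferentiableAt ℝ (fderiv ℝ F) z :=
    ((h.fderiv_right (m := 1) (by norm_cast)).differentiable one_ne_zero) z
  have e : ∀ v w, fderiv ℝ (fun y => fderiv ℝ F y v) z w = fderiv ℝ (fderiv ℝ F) z w v := by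
    intro v w
    rw [fderiv_clm_apply hdf (differentiableAt_const v)]
    simp
  rw [e, e]
  exact hs w v

lemma aux_smooth {d : ℕ} {M : Type*} [NormedAddCommGroup M] [NormedSpace ℝ M]
    {F : SpTime d → M} (h : ContDiff ℝ (⊤ : ℕ∞) F) (v : SpTime d) :
    ContDiff ℝ (⊤ : ℕ∞) (fun z => fderiv ℝ F z v) :=
  (h.fderiv_right (by norm_cast)).clm_apply contDiff_const

/-- Directional derivative relation. -/
def HasD {d : ℕ} {M : Type*} [NormedAddCommGroup M] [NormedSpace ℝ M]
    (v : SpTime d) (F : SpTime d → M) (F' : M) (z : SpTime d) : Prop :=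
  DifferentiableAt ℝ F z ∧ fderiv ℝ F z v = F'

namespace HasD
variable {d : ℕ} {M : Type*} [NormedAddCommGroup M] [NormedSpace ℝ M] {v z : SpTime d}

lemma of_diff {F : SpTime d → M} (h : DifferentiableAt ℝ F z) : HasD v F (fderiv ℝ F z v) z :=
  ⟨h, rfl⟩

lemma of_cd {F : SpTime d → M} (h : ContDiff ℝ (⊤ : ℕ∞) F) : HasD v F (fderiv ℝ F z v) z :=
  ⟨h.differentiable (by simp) z, rfl⟩

lemma add {F G : SpTime d → M} {F' G' : M} (hF : HasD v F F' z) (hG : HasD v G G' z) :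
    HasD v (fun w => F w + G w) (F' + G') z :=
  ⟨hF.1.add hG.1, by rw [fderiv_fun_add hF.1 hG.1, ← hF.2, ← hG.2]; rfl⟩

lemma sub {F G : SpTime d → M} {F' G' : M} (hF : HasD v F F' z) (hG : HasD v G G' z) :
    HasD v (fun w => F w - G w) (F' - G') z :=
  ⟨hF.1.sub hG.1, by rw [fderiv_fun_sub hF.1 hG.1, ← hF.2, ← hG.2]; rfl⟩

lemma mul {F G : SpTime d → ℝ} {F' G' : ℝ} (hF : HasD v F F' z) (hG : HasD v G G' z) :
    HasD v (fun w => F w * G w) (F' * G z + F z * G') z :=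
  ⟨hF.1.mul hG.1, by
    rw [fderiv_fun_mul hF.1 hG.1, ← hF.2, ← hG.2]; simp; ring⟩

lemma cmul (c : ℝ) {F : SpTime d → ℝ} {F' : ℝ} (hF : HasD v F F' z) :
    HasD v (fun w => c * F w) (c * F') z :=
  ⟨hF.1.const_mul c, by rw [fderiv_const_mul hF.1, ← hF.2]; rfl⟩

lemma sum {ι : Type*} (s : Finset ι) {F : ι → SpTime d → M} {F' : ι → M}
    (hF : ∀ i, HasD v (F i) (F' i) z) :
    HasD v (fun w => ∑ i ∈ s, F i w) (∑ i ∈ s, F' i) z :=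
  ⟨DifferentiableAt.fun_sum fun i _ => (hF i).1, by
    rw [fderiv_fun_sum fun i _ => (hF i).1]
    simp [(hF _).2]⟩

lemma entry {F : SpTime d → Matrix (Fin d) (Fin d) ℝ} {F' : Matrix (Fin d) (Fin d) ℝ}
    (hF : HasD v F F' z) (i j : Fin d) : HasD v (fun w => F w i j) (F' i j) z := by
  have h1 := hF.1.hasFDerivAt
  have h2 := hasFDerivAt_pi'.1 (hasFDerivAt_pi'.1 h1 i) j
  refine ⟨h2.differentiableAt, ?_⟩
  rw [h2.fderiv, ← hF.2]
  rfl

lemma coord {F : SpTime d → (Fin d → ℝ)} {F' : Fin d → ℝ}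
    (hF : HasD v F F' z) (i : Fin d) : HasD v (fun w => F w i) (F' i) z := by
  have h2 := hasFDerivAt_pi'.1 hF.1.hasFDerivAt i
  refine ⟨h2.differentiableAt, ?_⟩
  rw [h2.fderiv, ← hF.2]
  rfl

end HasD

/-- Frobenius pairing. -/
def ip {d : ℕ} (A B : Matrix (Fin d) (Fin d) ℝ) : ℝ := ∑ i, ∑ j, A i j * B i j

section ipsec
variable {d : ℕ} (A B C : Matrix (Fin d) (Fin d) ℝ)

lemma ip_add_left : ip (A + B) C = ip A C + ip B C := by
  simp [ip, add_mul, Finset.sum_add_distrib]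
lemma ip_sub_left : ip (A - B) C = ip A C - ip B C := by
  simp [ip, sub_mul, Finset.sum_sub_distrib]
lemma ip_smul_left (c : ℝ) : ip (c • A) B = c * ip A B := by
  simp [ip, Finset.mul_sum, mul_assoc]
lemma ip_comm : ip A B = ip B A := by
  simp [ip, mul_comm]
lemma ip_add_right : ip C (A + B) = ip C A + ip C B := by
  rw [ip_comm, ip_add_left, ip_comm A, ip_comm B]
lemma ip_sub_right : ip C (A - B) = ip C A - ip C B := by
  rw [ip_comm, ip_sub_left, ip_comm A, ip_comm B]
lemma ip_smul_right (c : ℝ) : ip A (c • B) = c * ip A B := by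
  rw [ip_comm, ip_smul_left, ip_comm]
lemma ip_sum_right {ι : Type*} (s : Finset ι) (F : ι → Matrix (Fin d) (Fin d) ℝ) :
    ip A (∑ k ∈ s, F k) = ∑ k ∈ s, ip A (F k) := by
  simp only [ip, Matrix.sum_apply, Finset.mul_sum]
  conv_rhs => rw [Finset.sum_comm]
  refine Finset.sum_congr rfl fun i _ => ?_
  rw [Finset.sum_comm]
lemma ip_sum_left {ι : Type*} (s : Finset ι) (F : ι → Matrix (Fin d) (Fin d) ℝ) :
    ip (∑ k ∈ s, F k) A = ∑ k ∈ s, ip (F k) A := by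
  rw [ip_comm, ip_sum_right]; simp only [ip_comm A]
lemma ip_one : ip 1 A = A.trace := by
  simp [ip, Matrix.one_apply, Matrix.trace]
lemma ip_eq_trace : ip A B = (Aᵀ * B).trace := by
  simp only [ip, Matrix.trace, Matrix.mul_apply, Matrix.diag, Matrix.transpose_apply]
  rw [Finset.sum_comm]
lemma ip_tfree (hB : B.trace = 0) : ip (tfree A) B = ip A B := by
  rw [tfree, ip_sub_left, ip_smul_left, ip_one, hB]; ring
end ipsec

lemma HasD.ip {d : ℕ} {v z : SpTime d} {F G : SpTime d → Matrix (Fin d) (Fin d) ℝ}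
    {F' G' : Matrix (Fin d) (Fin d) ℝ} (hF : HasD v F F' z) (hG : HasD v G G' z) :
    HasD v (fun w => ip (F w) (G w)) (ip F' (G z) + ip (F z) G') z := by
  have := HasD.sum Finset.univ fun i => HasD.sum Finset.univ fun j =>
    (hF.entry i j).mul (hG.entry i j)
  simpa [_root_.ip, Finset.sum_add_distrib] using this

/-- The algebraic cancellation between the tumbling term and the stresses. -/
lemma aux_alg {d : ℕ} (ξ : ℝ) (A Q H : Matrix (Fin d) (Fin d) ℝ)
    (hA : A.trace = 0) (hQ : Qᵀ = Q) (hH : Hᵀ = H) (hHt : H.trace = 0) :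
    ip A ((-ξ) • ((Q + ((1 : ℝ) / d) • (1 : Matrix (Fin d) (Fin d) ℝ)) * H)
      + (-ξ) • (H * (Q + ((1 : ℝ) / d) • 1))
      + (2 * ξ * (Q * H).trace) • (Q + ((1 : ℝ) / d) • 1) + (Q * H - H * Q))
    = - ip H (((((1 : ℝ) / 2) • (A - Aᵀ)) + ξ • (((1 : ℝ) / 2) • (A + Aᵀ)))
        * (Q + ((1 : ℝ) / d) • 1)
      - (Q + ((1 : ℝ) / d) • 1) * ((((1 : ℝ) / 2) • (A - Aᵀ)) - ξ • (((1 : ℝ) / 2) • (A + Aᵀ)))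
      - (2 * ξ * (Q * A).trace) • (Q + ((1 : ℝ) / d) • 1)) := by
  have c1 : (Aᵀ * (Q * H)).trace = (A * (H * Q)).trace := by
    rw [← Matrix.trace_transpose]; simp only [Matrix.transpose_mul, Matrix.transpose_transpose, hQ, hH]
    rw [Matrix.trace_mul_comm]
  have c2 : (Aᵀ * (H * Q)).trace = (A * (Q * H)).trace := by
    rw [← Matrix.trace_transpose]; simp only [Matrix.transpose_mul, Matrix.transpose_transpose, hQ, hH]
    rw [Matrix.trace_mul_comm]
  have c3 : (H * (A * Q)).trace = (A * (Q * H)).trace := by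
    rw [Matrix.trace_mul_comm, Matrix.mul_assoc]
  have c4 : (H * (Aᵀ * Q)).trace = (A * (H * Q)).trace := by
    rw [Matrix.trace_mul_comm, Matrix.mul_assoc, c1]
  have c5 : (H * (Q * A)).trace = (A * (H * Q)).trace := by
    rw [← Matrix.mul_assoc, Matrix.trace_mul_comm]
  have c6 : (H * (Q * Aᵀ)).trace = (A * (Q * H)).trace := by
    rw [← Matrix.mul_assoc, Matrix.trace_mul_comm, c2]
  have c7 : (Aᵀ * H).trace = (A * H).trace := by
    rw [← Matrix.trace_transpose]; simp only [Matrix.transpose_mul, Matrix.transpose_transpose, hH]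
    rw [Matrix.trace_mul_comm]
  have c8 : (H * A).trace = (A * H).trace := Matrix.trace_mul_comm _ _
  have c9 : (H * Aᵀ).trace = (A * H).trace := by rw [Matrix.trace_mul_comm, c7]
  have c10 : (Q * H).trace = (H * Q).trace := Matrix.trace_mul_comm _ _
  have c11 : (Aᵀ * Q).trace = (A * Q).trace := by
    rw [← Matrix.trace_transpose]; simp only [Matrix.transpose_mul, Matrix.transpose_transpose, hQ]
    rw [Matrix.trace_mul_comm]
  have c12 : (Q * A).trace = (A * Q).trace := Matrix.trace_mul_comm _ _
  have c13 : (Aᵀ).trace = 0 := by rw [Matrix.trace_transpose, hA]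
  simp only [ip_eq_trace, hH, Matrix.mul_add, Matrix.add_mul, Matrix.mul_sub, Matrix.sub_mul,
    Matrix.mul_smul, Matrix.smul_mul, smul_add, smul_sub, Matrix.trace_add, Matrix.trace_sub,
    Matrix.trace_smul, Matrix.mul_one, Matrix.one_mul, smul_eq_mul, c1, c2, c3, c4, c5, c6, c7, c8,
    c9, c10, c11, c12, c13, hHt]
  ring

lemma mat_cd {d : ℕ} {n : WithTop ℕ∞} {F : SpTime d → Matrix (Fin d) (Fin d) ℝ}
    (h : ∀ i j, ContDiff ℝ n (fun w => F w i j)) : ContDiff ℝ n F :=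
  contDiff_pi.2 fun i => contDiff_pi.2 fun j => h i j

lemma cd_entry {d : ℕ} {n : WithTop ℕ∞} {F : SpTime d → Matrix (Fin d) (Fin d) ℝ}
    (h : ContDiff ℝ n F) (i j : Fin d) : ContDiff ℝ n (fun w => F w i j) :=
  contDiff_pi.1 (contDiff_pi.1 h i) j

lemma cd_mul {d : ℕ} {n : WithTop ℕ∞} {F G : SpTime d → Matrix (Fin d) (Fin d) ℝ}
    (hF : ContDiff ℝ n F) (hG : ContDiff ℝ n G) : ContDiff ℝ n (fun w => F w * G w) := by
  refine mat_cd fun i j => ?_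
  simp only [Matrix.mul_apply]
  exact ContDiff.sum fun k _ => (cd_entry hF i k).mul (cd_entry hG k j)

lemma cd_trace {d : ℕ} {n : WithTop ℕ∞} {F : SpTime d → Matrix (Fin d) (Fin d) ℝ}
    (hF : ContDiff ℝ n F) : ContDiff ℝ n (fun w => (F w).trace) := by
  simp only [Matrix.trace, Matrix.diag]
  exact ContDiff.sum fun k _ => cd_entry hF k k

lemma cd_transpose {d : ℕ} {n : WithTop ℕ∞} {F : SpTime d → Matrix (Fin d) (Fin d) ℝ}
    (hF : ContDiff ℝ n F) : ContDiff ℝ n (fun w => (F w)ᵀ) :=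
  mat_cd fun i j => cd_entry hF j i

/-- Smooth expression equal to the molecular field on the time interval. -/
def fieldK {d : ℕ} (Γ ξ : ℝ) (u : SpTime d → (Fin d → ℝ))
    (Q : SpTime d → Matrix (Fin d) (Fin d) ℝ) (z : SpTime d) : Matrix (Fin d) (Fin d) ℝ :=
  Γ⁻¹ • (tpd Q z + (∑ i : Fin d, u z i • spd i Q z) - tumbling ξ u Q z)

/-- The total stress with a generic field in place of the molecular field. -/
def stressOf {d : ℕ} (ξ L : ℝ) (Q H : SpTime d → Matrix (Fin d) (Fin d) ℝ) (z : SpTime d) :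
    Matrix (Fin d) (Fin d) ℝ :=
  (-ξ) • ((Q z + ((1 : ℝ) / d) • 1) * H z)
    + (-ξ) • (H z * (Q z + ((1 : ℝ) / d) • 1))
    + (2 * ξ * (Q z * H z).trace) • (Q z + ((1 : ℝ) / d) • 1)
    - L • (Matrix.of fun i j => (spd i Q z * spd j Q z).trace)
    + (Q z * H z - H z * Q z)

lemma cd_gradVel {d : ℕ} {u : SpTime d → (Fin d → ℝ)} (hu : ContDiff ℝ (⊤ : ℕ∞) u) :
    ContDiff ℝ (⊤ : ℕ∞) (gradVel u) :=
  mat_cd fun i j => contDiff_pi.1 (aux_smooth hu (sdir d j)) i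

lemma cd_fieldK {d : ℕ} (Γ ξ : ℝ) {u : SpTime d → (Fin d → ℝ)}
    {Q : SpTime d → Matrix (Fin d) (Fin d) ℝ} (hu : ContDiff ℝ (⊤ : ℕ∞) u)
    (hQ : ContDiff ℝ (⊤ : ℕ∞) Q) : ContDiff ℝ (⊤ : ℕ∞) (fieldK Γ ξ u Q) := by
  have hA := cd_gradVel hu
  have hs : ContDiff ℝ (⊤ : ℕ∞) (skewPart u) := (hA.sub (cd_transpose hA)).const_smul _
  have hsy : ContDiff ℝ (⊤ : ℕ∞) (symPart u) := (hA.add (cd_transpose hA)).const_smul _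
  have hB : ContDiff ℝ (⊤ : ℕ∞)
      (fun z => Q z + ((1 : ℝ) / d) • (1 : Matrix (Fin d) (Fin d) ℝ)) := hQ.add contDiff_const
  refine ContDiff.const_smul _ (((aux_smooth hQ _).add ?_).sub ?_)
  · exact ContDiff.sum fun i _ => (contDiff_pi.1 hu i).smul (aux_smooth hQ _)
  · exact ((cd_mul (hs.add (hsy.const_smul ξ)) hB).sub
      (cd_mul hB (hs.sub (hsy.const_smul ξ)))).sub
      ((contDiff_const.mul (cd_trace (cd_mul hQ hA))).smul hB)

lemma cd_stressOf {d : ℕ} (ξ L : ℝ) {Q H : SpTime d → Matrix (Fin d) (Fin d) ℝ}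
    (hQ : ContDiff ℝ (⊤ : ℕ∞) Q) (hH : ContDiff ℝ (⊤ : ℕ∞) H) :
    ContDiff ℝ (⊤ : ℕ∞) (stressOf ξ L Q H) := by
  have hB : ContDiff ℝ (⊤ : ℕ∞)
      (fun z => Q z + ((1 : ℝ) / d) • (1 : Matrix (Fin d) (Fin d) ℝ)) := hQ.add contDiff_const
  refine ((((cd_mul hB hH).const_smul _).add ((cd_mul hH hB).const_smul _)).add
    ((contDiff_const.mul (cd_trace (cd_mul hQ hH))).smul hB)).sub
    (ContDiff.const_smul _ (mat_cd fun i j => ?_)) |>.add ((cd_mul hQ hH).sub (cd_mul hH hQ))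
  exact cd_trace (cd_mul (aux_smooth hQ _) (aux_smooth hQ _))

lemma fderiv_trace_zero {d : ℕ} {Q : SpTime d → Matrix (Fin d) (Fin d) ℝ}
    (hQ : ContDiff ℝ (⊤ : ℕ∞) Q) (hQtr : ∀ z, (Q z).trace = 0) (z v : SpTime d) :
    (fderiv ℝ Q z v).trace = 0 := by
  have h := HasD.sum Finset.univ fun i => (HasD.of_cd (v := v) (z := z) hQ).entry i i
  have h0 : (fun w => ∑ i, Q w i i) = fun _ => (0 : ℝ) := funext fun w => hQtr w
  refine h.2.symm.trans ?_
  rw [h0]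
  simp

lemma fderiv_symm {d : ℕ} {Q : SpTime d → Matrix (Fin d) (Fin d) ℝ}
    (hQ : ContDiff ℝ (⊤ : ℕ∞) Q) (hQsym : ∀ z, (Q z)ᵀ = Q z) (z v : SpTime d) :
    (fderiv ℝ Q z v)ᵀ = fderiv ℝ Q z v := by
  ext i j
  have h1 := ((HasD.of_cd (v := v) (z := z) hQ).entry i j).2
  have h2 := ((HasD.of_cd (v := v) (z := z) hQ).entry j i).2
  refine h2.symm.trans (Eq.trans ?_ h1)
  have : (fun w => Q w j i) = fun w => Q w i j := by
    funext w
    exact congrFun (congrFun (hQsym w) i) j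
  rw [this]

lemma aux_final {d : ℕ} (L θ κ ν Γ : ℝ) (u ut pm gp qm : Fin d → ℝ) (A st dst uu Z W N : Fin d → Fin d → ℝ)
    (X Y hg : Fin d → ℝ) (α β hS hh hqt P : ℝ)
    (hdiv : ∑ m, A m m = 0)
    (hU : ∑ i, u i * ut i + ∑ i, u i * ∑ j, u j * A i j
      = ν * (∑ i, u i * ∑ m, uu m i) - ∑ i, u i * pm i + ∑ i, u i * ∑ j, dst i j)
    (hQe : hqt + ∑ k, u k * hg k - hS = Γ * hh)
    (hH1 : hqt = L * (∑ m, X m) - θ * α + κ * β)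
    (hH2 : ∀ k, hg k = L * (∑ m, Z m k) - θ * gp k + κ * qm k)
    (hSt : ∑ i, ∑ j, A i j * st i j = - hS - L * ∑ i, ∑ j, A i j * N j i) :
    ∑ i, u i * ut i + L * (∑ m, Y m) + θ * α - κ * β
      = -Γ * hh - ν * (∑ i, ∑ j, A i j ^ 2)
        + ∑ m, (L * (X m + Y m)
          - (A m m * P + u m * (∑ i, u i * A i m + pm m + θ * gp m - κ * qm m
              + L * ∑ k, W k m))
          + ∑ i, (A i m * (ν * A i m + st i m + L * N m i)
              + u i * (ν * uu m i + dst i m + L * (Z m i + W m i)))) := by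
  have e1 : ∑ k, u k * hg k = L * (∑ k, ∑ m, u k * Z m k) - θ * (∑ k, u k * gp k)
      + κ * ∑ k, u k * qm k := by
    simp only [hH2, mul_add, mul_sub, Finset.mul_sum, Finset.sum_add_distrib,
      Finset.sum_sub_distrib]
    congr 1
    · congr 1
      · exact Finset.sum_congr rfl fun _ _ => Finset.sum_congr rfl fun _ _ => by ring
      · exact Finset.sum_congr rfl fun _ _ => by ring
    · exact Finset.sum_congr rfl fun _ _ => by ring
  have e2 : ∑ m, (L * (X m + Y m)
          - (A m m * P + u m * (∑ i, u i * A i m + pm m + θ * gp m - κ * qm m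
              + L * ∑ k, W k m))
          + ∑ i, (A i m * (ν * A i m + st i m + L * N m i)
              + u i * (ν * uu m i + dst i m + L * (Z m i + W m i))))
      = L * (∑ m, X m) + L * (∑ m, Y m) - (∑ m, A m m) * P
        - (∑ m, ∑ i, u m * (u i * A i m)) - (∑ m, u m * pm m) - θ * (∑ m, u m * gp m)
        + κ * (∑ m, u m * qm m) - L * (∑ m, ∑ k, u m * W k m)
        + ν * (∑ m, ∑ i, A i m ^ 2) + (∑ m, ∑ i, A i m * st i m)
        + L * (∑ m, ∑ i, A i m * N m i) + ν * (∑ m, ∑ i, u i * uu m i)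
        + (∑ m, ∑ i, u i * dst i m) + L * (∑ m, ∑ i, u i * Z m i)
        + L * (∑ m, ∑ i, u i * W m i) := by
    simp only [Finset.mul_sum, Finset.sum_mul, ← Finset.sum_add_distrib, ← Finset.sum_sub_distrib]
    refine Finset.sum_congr rfl fun m _ => ?_
    have r : u m * ((∑ i, u i * A i m) + pm m + θ * gp m - κ * qm m + ∑ k, L * W k m)
      = (∑ i, u m * (u i * A i m)) + u m * pm m + u m * (θ * gp m) - u m * (κ * qm m)
        + ∑ k, L * (u m * W k m) := by
      rw [mul_add, mul_sub, mul_add, mul_add, Finset.mul_sum, Finset.mul_sum]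
      congr 1
      exact Finset.sum_congr rfl fun _ _ => by ring
    have r2 : ∑ i, (A i m * (ν * A i m + st i m + L * N m i)
              + u i * (ν * uu m i + dst i m + L * (Z m i + W m i)))
      = ∑ i, ν * A i m ^ 2 + ∑ i, A i m * st i m + ∑ i, L * (A i m * N m i)
       + ∑ i, ν * (u i * uu m i) + ∑ i, u i * dst i m + ∑ i, L * (u i * Z m i)
       + ∑ i, L * (u i * W m i) := by
      simp only [← Finset.sum_add_distrib]
      exact Finset.sum_congr rfl fun _ _ => by ring
    rw [r, r2]; ring
  have s1 : ∑ m, ∑ k, u m * W k m = ∑ m, ∑ i, u i * W m i := Finset.sum_comm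
  have s2 : ∑ m, ∑ i, A i m ^ 2 = ∑ i, ∑ j, A i j ^ 2 := Finset.sum_comm
  have s3 : ∑ m, ∑ i, A i m * st i m = ∑ i, ∑ j, A i j * st i j := Finset.sum_comm
  have s4 : ∑ m, ∑ i, A i m * N m i = ∑ i, ∑ j, A i j * N j i := Finset.sum_comm
  have s5 : ∑ m, ∑ i, u i * uu m i = ∑ i, ∑ m, u i * uu m i := Finset.sum_comm
  have s6 : ∑ m, ∑ i, u i * dst i m = ∑ i, ∑ j, u i * dst i j := Finset.sum_comm
  have s7 : ∑ m, ∑ i, u i * Z m i = ∑ k, ∑ m, u k * Z m k := Finset.sum_comm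
  have s8 : ∑ m, ∑ i, u m * (u i * A i m) = ∑ i, ∑ j, u i * (u j * A i j) := by
    rw [Finset.sum_comm]
    exact Finset.sum_congr rfl fun _ _ => Finset.sum_congr rfl fun _ _ => by ring
  rw [e2, s1, s2, s3, s4, s5, s6, s7, s8, hdiv]
  simp only [Finset.mul_sum] at hU hSt e1 hH1 ⊢
  simp only [← Finset.mul_sum] at hU hSt e1 hH1 ⊢
  linear_combination hU - hQe + e1 + hH1 - hSt

lemma HasD.psi {d : ℕ} {ψ : Matrix (Fin d) (Fin d) ℝ → ℝ} (hψ : ContDiff ℝ 1 ψ)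
    {gradψ : Matrix (Fin d) (Fin d) ℝ → Matrix (Fin d) (Fin d) ℝ}
    (hgrad : ∀ X Y : Matrix (Fin d) (Fin d) ℝ, fderiv ℝ ψ X Y = ((gradψ X)ᵀ * Y).trace)
    {Q : SpTime d → Matrix (Fin d) (Fin d) ℝ} {v z : SpTime d} {Q' : Matrix (Fin d) (Fin d) ℝ}
    (hQ : HasD v Q Q' z) :
    HasD v (fun w => ψ (Q w)) (_root_.ip (gradψ (Q z)) Q') z := by
  have h1 : HasFDerivAt ψ (fderiv ℝ ψ (Q z)) (Q z) :=
    (hψ.differentiable one_ne_zero _).hasFDerivAt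
  have h2 := h1.comp z hQ.1.hasFDerivAt
  refine ⟨h2.differentiableAt, ?_⟩
  refine (congrArg (fun f => f v) h2.fderiv).trans ?_
  rw [ip_eq_trace, ← hgrad, ← hQ.2]
  rfl

/-- Energy density. -/
def enDens {d : ℕ} (L θ κ : ℝ) (ψ : Matrix (Fin d) (Fin d) ℝ → ℝ)
    (Q : SpTime d → Matrix (Fin d) (Fin d) ℝ) (u : SpTime d → (Fin d → ℝ)) (w : SpTime d) : ℝ :=
  (1 : ℝ) / 2 * (∑ i : Fin d, u w i * u w i)
    + L / 2 * (∑ m : Fin d, ip (spd m Q w) (spd m Q w))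
    + θ * ψ (Q w) - κ / 2 * ip (Q w) (Q w)

/-- Total pressure. -/
def totPr {d : ℕ} (L θ κ : ℝ) (ψ : Matrix (Fin d) (Fin d) ℝ → ℝ)
    (Q : SpTime d → Matrix (Fin d) (Fin d) ℝ) (u : SpTime d → (Fin d → ℝ))
    (pr : SpTime d → ℝ) (w : SpTime d) : ℝ :=
  (1 : ℝ) / 2 * (∑ i : Fin d, u w i * u w i) + pr w
    + θ * ψ (Q w) - κ / 2 * ip (Q w) (Q w)
    + L / 2 * (∑ m : Fin d, ip (spd m Q w) (spd m Q w))

/-- Energy flux. -/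
def flux {d : ℕ} (ξ L θ κ ν : ℝ) (ψ : Matrix (Fin d) (Fin d) ℝ → ℝ)
    (gradψ : Matrix (Fin d) (Fin d) ℝ → Matrix (Fin d) (Fin d) ℝ)
    (Q : SpTime d → Matrix (Fin d) (Fin d) ℝ) (u : SpTime d → (Fin d → ℝ))
    (pr : SpTime d → ℝ) (m : Fin d) (w : SpTime d) : ℝ :=
  L * ip (spd m Q w) (tpd Q w) - u w m * totPr L θ κ ψ Q u pr w
    + ∑ i, u w i * (ν * spd m u w i
        + (tauStress ξ L θ κ gradψ Q w i m + sigmaStress L θ κ gradψ Q w i m)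
        + L * ip (spd m Q w) (spd i Q w))

section fluxsec
variable {d : ℕ} {ξ Γ L θ κ ν : ℝ} {ψ : Matrix (Fin d) (Fin d) ℝ → ℝ}
    {gradψ : Matrix (Fin d) (Fin d) ℝ → Matrix (Fin d) (Fin d) ℝ}
    {Q : SpTime d → Matrix (Fin d) (Fin d) ℝ} {u : SpTime d → (Fin d → ℝ)} {pr : SpTime d → ℝ}

lemma hasD_enDens (hψ : ContDiff ℝ 1 ψ)
    (hgrad : ∀ X Y : Matrix (Fin d) (Fin d) ℝ, fderiv ℝ ψ X Y = ((gradψ X)ᵀ * Y).trace)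
    (hQ : ContDiff ℝ (⊤ : ℕ∞) Q) (hu : ContDiff ℝ (⊤ : ℕ∞) u) (z : SpTime d) :
    tpd (enDens L θ κ ψ Q u) z = ∑ i, u z i * tpd u z i
      + L * (∑ m, ip (spd m Q z) (spd m (tpd Q) z))
      + θ * ip (gradψ (Q z)) (tpd Q z) - κ * ip (Q z) (tpd Q z) := by
  have hq : HasD (tdir d) Q (tpd Q z) z := HasD.of_cd hQ
  have hg : ∀ m, HasD (tdir d) (spd m Q) (spd m (tpd Q) z) z := fun m =>
    ⟨(aux_smooth hQ _).differentiable (by simp) z, aux_comm hQ _ _ z⟩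
  have hu' : HasD (tdir d) u (tpd u z) z := HasD.of_cd hu
  have := (((HasD.cmul (1 / 2) (HasD.sum Finset.univ fun i => (hu'.coord i).mul (hu'.coord i))).add
    (HasD.cmul (L / 2) (HasD.sum Finset.univ fun m => (hg m).ip (hg m)))).add
    (HasD.cmul θ (hq.psi hψ hgrad))).sub (HasD.cmul (κ / 2) (hq.ip hq))
  refine this.2.trans ?_
  have a1 : ∑ i, (tpd u z i * u z i + u z i * tpd u z i) = 2 * ∑ i, u z i * tpd u z i := by
    rw [Finset.mul_sum]; exact Finset.sum_congr rfl fun _ _ => by ring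
  have a2 : ∑ m, (ip (spd m (tpd Q) z) (spd m Q z) + ip (spd m Q z) (spd m (tpd Q) z))
      = 2 * ∑ m, ip (spd m Q z) (spd m (tpd Q) z) := by
    rw [Finset.mul_sum]
    exact Finset.sum_congr rfl fun _ _ => by rw [ip_comm (spd _ (tpd Q) z)]; ring
  rw [a1, a2, ip_comm (tpd Q z)]
  ring

lemma hasD_totPr (hψ : ContDiff ℝ 1 ψ)
    (hgrad : ∀ X Y : Matrix (Fin d) (Fin d) ℝ, fderiv ℝ ψ X Y = ((gradψ X)ᵀ * Y).trace)
    (hQ : ContDiff ℝ (⊤ : ℕ∞) Q) (hu : ContDiff ℝ (⊤ : ℕ∞) u) (hpr : ContDiff ℝ (⊤ : ℕ∞) pr)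
    (z : SpTime d) (m : Fin d) :
    HasD (sdir d m) (totPr L θ κ ψ Q u pr) (∑ i, u z i * spd m u z i + spd m pr z
      + θ * ip (gradψ (Q z)) (spd m Q z) - κ * ip (Q z) (spd m Q z)
      + L * (∑ k, ip (spd k Q z) (spd m (spd k Q) z))) z := by
  have hq : HasD (sdir d m) Q (spd m Q z) z := HasD.of_cd hQ
  have hp : HasD (sdir d m) pr (spd m pr z) z := HasD.of_cd hpr
  have hg : ∀ k, HasD (sdir d m) (spd k Q) (spd m (spd k Q) z) z := fun k =>
    HasD.of_cd (aux_smooth hQ _)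
  have hu' : HasD (sdir d m) u (spd m u z) z := HasD.of_cd hu
  have := ((((HasD.cmul (1 / 2)
    (HasD.sum Finset.univ fun i => (hu'.coord i).mul (hu'.coord i))).add hp).add
    (HasD.cmul θ (hq.psi hψ hgrad))).sub (HasD.cmul (κ / 2) (hq.ip hq))).add
    (HasD.cmul (L / 2) (HasD.sum Finset.univ fun k => (hg k).ip (hg k)))
  refine ⟨this.1, this.2.trans ?_⟩
  have a1 : ∑ i, (spd m u z i * u z i + u z i * spd m u z i) = 2 * ∑ i, u z i * spd m u z i := by
    rw [Finset.mul_sum]; exact Finset.sum_congr rfl fun _ _ => by ring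
  have a2 : ∑ k, (ip (spd m (spd k Q) z) (spd k Q z) + ip (spd k Q z) (spd m (spd k Q) z))
      = 2 * ∑ k, ip (spd k Q z) (spd m (spd k Q) z) := by
    rw [Finset.mul_sum]
    exact Finset.sum_congr rfl fun _ _ => by rw [ip_comm (spd m (spd _ Q) z)]; ring
  rw [a1, a2, ip_comm (spd m Q z)]
  ring

lemma hasD_flux (hψ : ContDiff ℝ 1 ψ)
    (hgrad : ∀ X Y : Matrix (Fin d) (Fin d) ℝ, fderiv ℝ ψ X Y = ((gradψ X)ᵀ * Y).trace)
    (hQ : ContDiff ℝ (⊤ : ℕ∞) Q) (hu : ContDiff ℝ (⊤ : ℕ∞) u) (hpr : ContDiff ℝ (⊤ : ℕ∞) pr)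
    (z : SpTime d)
    (hst : ∀ i j, DifferentiableAt ℝ (fun w => tauStress ξ L θ κ gradψ Q w i j
                + sigmaStress L θ κ gradψ Q w i j) z) (m : Fin d) :
    HasD (sdir d m) (flux ξ L θ κ ν ψ gradψ Q u pr m)
      (L * (ip (spd m (spd m Q) z) (tpd Q z) + ip (spd m Q z) (spd m (tpd Q) z))
        - (spd m u z m * totPr L θ κ ψ Q u pr z
          + u z m * (∑ i, u z i * spd m u z i + spd m pr z
            + θ * ip (gradψ (Q z)) (spd m Q z) - κ * ip (Q z) (spd m Q z)
            + L * (∑ k, ip (spd k Q z) (spd m (spd k Q) z))))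
        + ∑ i, (spd m u z i * (ν * spd m u z i
            + (tauStress ξ L θ κ gradψ Q z i m + sigmaStress L θ κ gradψ Q z i m)
            + L * ip (spd m Q z) (spd i Q z))
          + u z i * (ν * spd m (spd m u) z i
            + spd m (fun w => tauStress ξ L θ κ gradψ Q w i m
                + sigmaStress L θ κ gradψ Q w i m) z
            + L * (ip (spd m (spd m Q) z) (spd i Q z)
              + ip (spd m Q z) (spd i (spd m Q) z))))) z := by
  have hg : ∀ k, HasD (sdir d m) (spd k Q) (spd m (spd k Q) z) z := fun k =>
    HasD.of_cd (aux_smooth hQ _)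
  have hg' : ∀ k, HasD (sdir d m) (spd k Q) (spd k (spd m Q) z) z := fun k =>
    ⟨(aux_smooth hQ _).differentiable (by simp) z, aux_comm hQ _ _ z⟩
  have hqt : HasD (sdir d m) (tpd Q) (spd m (tpd Q) z) z := HasD.of_cd (aux_smooth hQ _)
  have hu' : HasD (sdir d m) u (spd m u z) z := HasD.of_cd hu
  have hmu : HasD (sdir d m) (spd m u) (spd m (spd m u) z) z := HasD.of_cd (aux_smooth hu _)
  exact ((HasD.cmul L ((hg m).ip hqt)).sub
    ((hu'.coord m).mul (hasD_totPr hψ hgrad hQ hu hpr z m))).add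
    (HasD.sum Finset.univ fun i => (hu'.coord i).mul
      (((HasD.cmul ν (hmu.coord i)).add (HasD.of_diff (hst i m))).add
        (HasD.cmul L ((hg m).ip (hg' i)))))

lemma per_flux {Λ : ℝ} (hQper : IsCubePeriodicST Λ Q) (huper : IsCubePeriodicST Λ u)
    (hprper : IsCubePeriodicST Λ pr) (m : Fin d) :
    IsCubePeriodicST Λ (flux ξ L θ κ ν ψ gradψ Q u pr m) := by
  intro z k
  have h1 := hQper z k
  have h2 := huper z k
  have h3 := hprper z k
  have h4 : ∀ m, spd m Q _ = spd m Q z := fun m => aux_per_fderiv hQper (sdir d m) z k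
  have h5 : ∀ m, spd m u _ = spd m u z := fun m => aux_per_fderiv huper (sdir d m) z k
  have h6 : tpd Q _ = tpd Q z := aux_per_fderiv hQper (tdir d) z k
  have h7 : ∀ m, spd m (spd m Q) _ = spd m (spd m Q) z := fun m =>
    aux_per_fderiv (aux_per_fderiv hQper (sdir d m)) (sdir d m) z k
  simp only [flux, totPr, tauStress, sigmaStress, molecularField, slap, h1, h2, h3, h4, h5, h6, h7]

lemma cd_ip {n : WithTop ℕ∞} {F G : SpTime d → Matrix (Fin d) (Fin d) ℝ}
    (hF : ContDiff ℝ n F) (hG : ContDiff ℝ n G) : ContDiff ℝ n (fun w => ip (F w) (G w)) :=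
  ContDiff.sum fun i _ => ContDiff.sum fun j _ => (cd_entry hF i j).mul (cd_entry hG i j)

lemma cd_enDens (hψ : ContDiff ℝ 1 ψ) (hQ : ContDiff ℝ (⊤ : ℕ∞) Q)
    (hu : ContDiff ℝ (⊤ : ℕ∞) u) : ContDiff ℝ 1 (enDens L θ κ ψ Q u) := by
  have h1 : (1 : WithTop ℕ∞) ≤ ((⊤ : ℕ∞) : WithTop ℕ∞) :=
    WithTop.coe_le_coe.2 (le_top : (1 : ℕ∞) ≤ ⊤)
  have hu1 := hu.of_le h1
  have hQ1 := hQ.of_le h1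
  have hg : ∀ m, ContDiff ℝ 1 (spd m Q) := fun m => (aux_smooth hQ _).of_le h1
  exact (((contDiff_const.mul (ContDiff.sum fun i _ =>
    (contDiff_pi.1 hu1 i).mul (contDiff_pi.1 hu1 i))).add
    (contDiff_const.mul (ContDiff.sum fun m _ => cd_ip (hg m) (hg m)))).add
    (contDiff_const.mul (hψ.comp hQ1))).sub (contDiff_const.mul (cd_ip hQ1 hQ1))

lemma pointwise (hd : (d : ℝ) ≠ 0) (hψ : ContDiff ℝ 1 ψ)
    (hgrad : ∀ X Y : Matrix (Fin d) (Fin d) ℝ, fderiv ℝ ψ X Y = ((gradψ X)ᵀ * Y).trace)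
    (hQ : ContDiff ℝ (⊤ : ℕ∞) Q)
    (hQsym : ∀ z, (Q z)ᵀ = Q z) (hQtr : ∀ z, (Q z).trace = 0)
    (hu : ContDiff ℝ (⊤ : ℕ∞) u) (hdiv : ∀ z, ∑ i : Fin d, spd i u z i = 0)
    (hpr : ContDiff ℝ (⊤ : ℕ∞) pr) (z : SpTime d) (hΓ : 0 < Γ)
    (hst : ∀ i j, DifferentiableAt ℝ (fun w => tauStress ξ L θ κ gradψ Q w i j
                + sigmaStress L θ κ gradψ Q w i j) z)
    (heqQ : tpd Q z + (∑ i : Fin d, u z i • spd i Q z) - tumbling ξ u Q z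
        = Γ • molecularField L θ κ gradψ Q z)
    (hequ : tpd u z + (∑ j : Fin d, u z j • spd j u z)
        = ν • slap u z - (fun i => spd i pr z)
          + fun i => ∑ j : Fin d,
              spd j (fun w => tauStress ξ L θ κ gradψ Q w i j
                + sigmaStress L θ κ gradψ Q w i j) z) :
    tpd (enDens L θ κ ψ Q u) z
      = -Γ * ip (molecularField L θ κ gradψ Q z) (molecularField L θ κ gradψ Q z)
        - ν * (∑ i, ∑ j, spd j u z i ^ 2)
        + ∑ m, spd m (flux ξ L θ κ ν ψ gradψ Q u pr m) z := by
  have hgtr : ∀ m, (spd m Q z).trace = 0 := fun m => fderiv_trace_zero hQ hQtr z _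
  have hgs : ∀ m, (spd m Q z)ᵀ = spd m Q z := fun m => fderiv_symm hQ hQsym z _
  have htr : (tpd Q z).trace = 0 := fderiv_trace_zero hQ hQtr z _
  have hts : (tpd Q z)ᵀ = tpd Q z := fderiv_symm hQ hQsym z _
  set H := molecularField L θ κ gradψ Q z with hHdef
  have hlt : ∀ m, (spd m (spd m Q) z).trace = 0 := fun m =>
    fderiv_trace_zero (aux_smooth hQ (sdir d m)) (fun w => fderiv_trace_zero hQ hQtr w _) z _
  have hHtr : H.trace = 0 := by
    rw [hHdef, molecularField, slap, tfree]
    simp only [Matrix.trace_add, Matrix.trace_sub, Matrix.trace_smul, Matrix.trace_sum, hlt,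
      hQtr, Matrix.trace_one, Fintype.card_fin, smul_eq_mul, Finset.sum_const_zero]
    field_simp
    ring
  have hHsym : Hᵀ = H := by
    have h1 : H = Γ⁻¹ • (tpd Q z + (∑ i : Fin d, u z i • spd i Q z) - tumbling ξ u Q z) := by
      rw [heqQ, smul_smul, inv_mul_cancel₀ hΓ.ne', one_smul]
    have h2 : (tumbling ξ u Q z)ᵀ = tumbling ξ u Q z := by
      simp only [tumbling, skewPart, symPart, Matrix.transpose_sub, Matrix.transpose_add,
        Matrix.transpose_mul, Matrix.transpose_smul, Matrix.transpose_transpose,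
        Matrix.transpose_one, hQsym]
      simp only [Matrix.mul_add, Matrix.add_mul, Matrix.mul_sub, Matrix.sub_mul,
        Matrix.mul_smul, Matrix.smul_mul, smul_add, smul_sub]
      abel
    rw [h1]
    simp only [Matrix.transpose_sub, Matrix.transpose_add, Matrix.transpose_smul,
      Matrix.transpose_sum, hts, hgs, h2]
  have hHip : ∀ B : Matrix (Fin d) (Fin d) ℝ, B.trace = 0 → ip H B
      = L * (∑ m, ip (spd m (spd m Q) z) B) - θ * ip (gradψ (Q z)) B + κ * ip (Q z) B := by
    intro B hB
    rw [hHdef, molecularField, slap, ip_add_left, ip_sub_left, ip_smul_left, ip_smul_left,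
      ip_smul_left, ip_tfree _ _ hB, ip_sum_left]
  rw [hasD_enDens hψ hgrad hQ hu]
  have hfl : ∀ m, spd m (flux ξ L θ κ ν ψ gradψ Q u pr m) z = _ := fun m =>
    (hasD_flux (ν := ν) hψ hgrad hQ hu hpr z hst m).2
  rw [Finset.sum_congr rfl fun m _ => hfl m]
  refine aux_final L θ κ ν Γ (u z) (tpd u z) (fun m => spd m pr z)
    (fun m => ip (gradψ (Q z)) (spd m Q z)) (fun m => ip (Q z) (spd m Q z))
    (fun i j => spd j u z i)
    (fun i j => tauStress ξ L θ κ gradψ Q z i j + sigmaStress L θ κ gradψ Q z i j)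
    (fun i j => spd j (fun w => tauStress ξ L θ κ gradψ Q w i j
                + sigmaStress L θ κ gradψ Q w i j) z)
    (fun m i => spd m (spd m u) z i)
    (fun m i => ip (spd m (spd m Q) z) (spd i Q z))
    (fun k m => ip (spd k Q z) (spd m (spd k Q) z))
    (fun m i => ip (spd m Q z) (spd i Q z))
    (fun m => ip (spd m (spd m Q) z) (tpd Q z))
    (fun m => ip (spd m Q z) (spd m (tpd Q) z))
    (fun m => ip H (spd m Q z))
    (ip (gradψ (Q z)) (tpd Q z)) (ip (Q z) (tpd Q z)) (ip H (tumbling ξ u Q z)) (ip H H)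
    (ip H (tpd Q z)) (totPr L θ κ ψ Q u pr z) (hdiv z) ?_ ?_ (hHip _ htr)
    (fun k => hHip _ (hgtr k)) ?_
  · have : ∀ i, tpd u z i + ∑ j, u z j * spd j u z i = ν * (∑ m, spd m (spd m u) z i)
        - spd i pr z + ∑ j, spd j (fun w => tauStress ξ L θ κ gradψ Q w i j
                + sigmaStress L θ κ gradψ Q w i j) z := by
      intro i
      have := congrFun hequ i
      simpa [slap, Finset.sum_apply] using this
    rw [← Finset.sum_add_distrib, Finset.mul_sum, ← Finset.sum_sub_distrib,
      ← Finset.sum_add_distrib]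
    refine Finset.sum_congr rfl fun i _ => ?_
    linear_combination u z i * this i
  · have := congrArg (ip H) heqQ
    rw [ip_sub_right, ip_add_right, ip_sum_right, ip_smul_right] at this
    simpa only [ip_smul_right] using this
  · have hA : (gradVel u z).trace = 0 := hdiv z
    have key := aux_alg ξ (gradVel u z) (Q z) H hA (hQsym z) hHsym hHtr
    have key2 : ip (gradVel u z) (tauStress ξ L θ κ gradψ Q z + sigmaStress L θ κ gradψ Q z)
        = - ip H (tumbling ξ u Q z) - L * ip (gradVel u z)
          (Matrix.of fun i j => (spd i Q z * spd j Q z).trace) := by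
      rw [tumbling, skewPart, symPart, ← key, ← ip_smul_right, ← ip_sub_right, tauStress,
        sigmaStress]
      congr 1
      abel
    refine Eq.trans (show _ = ip (gradVel u z)
      (tauStress ξ L θ κ gradψ Q z + sigmaStress L θ κ gradψ Q z) from rfl) (key2.trans ?_)
    congr 2
    simp only [ip]
    refine Finset.sum_congr rfl fun i _ => Finset.sum_congr rfl fun j _ => ?_
    simp only [gradVel, Matrix.of_apply]
    congr 1
    have := ip_eq_trace (spd j Q z) (spd i Q z)
    rw [hgs] at this
    rw [Matrix.trace_mul_comm, ← this]
    rfl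

end fluxsec

/-- For smooth `I^d`-periodic solutions `(Q, u, p)` of the Beris–Edwards
system `∂_t Q + (u·∇)Q − S(Q,∇u) = ΓH`,
`∂_t u + (u·∇)u = νΔu − ∇p + div(τ+σ)`, `div u = 0`, the total energy
`E(t) = ∫_{I^d} (½|u|² + (L/2)|∇Q|² + θψ(Q) − (κ/2)tr[Q²]) dx` is differentiable on
`(0,T)` and satisfies `dE/dt = −Γ∫|H|² − ν∫|∇u|²`. -/
theorem energy_dissipation_identity (d : ℕ) (hd : d = 2 ∨ d = 3)
    (Λ ξ Γ L θ κ ν : ℝ) (hΛ : 0 < Λ) (hΓ : 0 < Γ) (hL : 0 < L) (hθ : 0 < θ)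
    (hκ : 0 < κ) (hν : 0 < ν)
    (ψ : Matrix (Fin d) (Fin d) ℝ → ℝ) (hψ : ContDiff ℝ 1 ψ)
    (gradψ : Matrix (Fin d) (Fin d) ℝ → Matrix (Fin d) (Fin d) ℝ)
    (hgrad : ∀ X Y : Matrix (Fin d) (Fin d) ℝ, fderiv ℝ ψ X Y = ((gradψ X)ᵀ * Y).trace)
    (T : ℝ) (hT : 0 < T)
    (Q : SpTime d → Matrix (Fin d) (Fin d) ℝ) (hQ : ContDiff ℝ (⊤ : ℕ∞) Q)
    (hQper : IsCubePeriodicST Λ Q)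
    (hQsym : ∀ z, (Q z)ᵀ = Q z) (hQtr : ∀ z, (Q z).trace = 0)
    (u : SpTime d → (Fin d → ℝ)) (hu : ContDiff ℝ (⊤ : ℕ∞) u)
    (huper : IsCubePeriodicST Λ u)
    (hdiv : ∀ z, ∑ i : Fin d, spd i u z i = 0)
    (pr : SpTime d → ℝ) (hpr : ContDiff ℝ (⊤ : ℕ∞) pr) (hprper : IsCubePeriodicST Λ pr)
    (heqQ : ∀ (x : Fin d → ℝ), ∀ t ∈ Set.Ioo (0 : ℝ) T,
      tpd Q (x, t) + (∑ i : Fin d, u (x, t) i • spd i Q (x, t)) - tumbling ξ u Q (x, t)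
        = Γ • molecularField L θ κ gradψ Q (x, t))
    (hequ : ∀ (x : Fin d → ℝ), ∀ t ∈ Set.Ioo (0 : ℝ) T,
      tpd u (x, t) + (∑ j : Fin d, u (x, t) j • spd j u (x, t))
        = ν • slap u (x, t) - (fun i => spd i pr (x, t))
          + fun i => ∑ j : Fin d,
              spd j (fun w => tauStress ξ L θ κ gradψ Q w i j
                + sigmaStress L θ κ gradψ Q w i j) (x, t)) :
    ∀ t ∈ Set.Ioo (0 : ℝ) T,
      HasDerivAt (fun s : ℝ => ∫ x in cube d Λ,
          ((1 : ℝ) / 2 * ∑ i : Fin d, u (x, s) i ^ 2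
            + L / 2 * ∑ m : Fin d, ((spd m Q (x, s))ᵀ * spd m Q (x, s)).trace
            + θ * ψ (Q (x, s))
            - κ / 2 * (Q (x, s) * Q (x, s)).trace))
        (-Γ * (∫ x in cube d Λ,
            ((molecularField L θ κ gradψ Q (x, t))ᵀ
              * molecularField L θ κ gradψ Q (x, t)).trace)
          - ν * ∫ x in cube d Λ, ∑ i : Fin d, ∑ j : Fin d, (spd j u (x, t) i) ^ 2) t := by
  have hd0 : (d : ℝ) ≠ 0 := by rcases hd with rfl | rfl <;> norm_num
  obtain ⟨n, rfl⟩ : ∃ n, d = n + 1 := by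
    rcases hd with rfl | rfl
    exacts [⟨1, rfl⟩, ⟨2, rfl⟩]
  intro t ht
  have hgs : ∀ m z, (spd m Q z)ᵀ = spd m Q z := fun m z => fderiv_symm hQ hQsym z _
  have hKsm := cd_fieldK Γ ξ hu hQ
  have hHK : ∀ w : SpTime (n+1), w.2 ∈ Set.Ioo (0 : ℝ) T →
      molecularField L θ κ gradψ Q w = fieldK Γ ξ u Q w := by
    intro w hw
    rw [fieldK, heqQ w.1 w.2 hw, smul_smul, inv_mul_cancel₀ hΓ.ne', one_smul]
  have hst : ∀ x i j, DifferentiableAt ℝ (fun w => tauStress ξ L θ κ gradψ Q w i j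
                + sigmaStress L θ κ gradψ Q w i j) (x, t) := by
    intro x i j
    have h1 : DifferentiableAt ℝ (fun w => stressOf ξ L Q (fieldK Γ ξ u Q) w i j) (x, t) :=
      (cd_entry (cd_stressOf ξ L hQ hKsm) i j).differentiable (by simp) _
    refine h1.congr_of_eventuallyEq ?_
    have hopen : ∀ᶠ w : SpTime (n+1) in nhds (x, t), w.2 ∈ Set.Ioo (0 : ℝ) T :=
      (isOpen_Ioo.preimage continuous_snd).mem_nhds ht
    filter_upwards [hopen] with w hw
    simp only [stressOf, ← hHK w hw]
    rfl
  have hpt : ∀ x, tpd (enDens L θ κ ψ Q u) (x, t) = _ := fun x =>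
    pointwise hd0 hψ hgrad hQ hQsym hQtr hu hdiv hpr (x, t) hΓ (hst x) (heqQ x t ht) (hequ x t ht)
  have hcx : Continuous fun x : Fin (n+1) → ℝ => ((x, t) : SpTime (n+1)) := by fun_prop
  have hcH : Continuous fun x : Fin (n+1) → ℝ =>
      ip (molecularField L θ κ gradψ Q (x, t)) (molecularField L θ κ gradψ Q (x, t)) := by
    have : (fun x : Fin (n+1) → ℝ =>
      ip (molecularField L θ κ gradψ Q (x, t)) (molecularField L θ κ gradψ Q (x, t)))
      = fun x => ip (fieldK Γ ξ u Q (x, t)) (fieldK Γ ξ u Q (x, t)) := by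
      funext x
      rw [hHK (x, t) ht]
    rw [this]
    exact (cd_ip hKsm hKsm).continuous.comp hcx
  have hcu : Continuous fun x : Fin (n+1) → ℝ =>
      ∑ i : Fin (n+1), ∑ j : Fin (n+1), (spd j u (x, t) i) ^ 2 := by
    refine continuous_finsetSum _ fun i _ => continuous_finsetSum _ fun j _ => ?_
    exact ((contDiff_pi.1 (aux_smooth hu (sdir _ j)) i).continuous.comp hcx).pow 2
  have hce : Continuous fun x : Fin (n+1) → ℝ => tpd (enDens L θ κ ψ Q u) (x, t) :=
    (((cd_enDens hψ hQ hu).continuous_fderiv one_ne_zero).clm_apply continuous_const).comp hcx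
  have hcd : Continuous fun x : Fin (n+1) → ℝ =>
      ∑ m, spd m (flux ξ L θ κ ν ψ gradψ Q u pr m) (x, t) := by
    have h0 := (hce.add (hcH.const_mul Γ)).add (hcu.const_mul ν)
    refine h0.congr fun x => ?_
    simp only [Pi.add_apply, hpt x]
    ring
  have hz := aux_div_zero Λ hΛ (fun m => flux ξ L θ κ ν ψ gradψ Q u pr m) t
    (fun m x => (hasD_flux hψ hgrad hQ hu hpr (x, t) (hst x) m).1)
    (fun m => per_flux hQper huper hprper m) hcd
  have hI : ∀ {f : (Fin (n+1) → ℝ) → ℝ}, Continuous f →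
      Integrable f (volume.restrict (cube (n+1) Λ)) := fun hf =>
    hf.continuousOn.integrableOn_compact isCompact_Icc
  have hmain := aux_deriv_integral Λ (enDens L θ κ ψ Q u) (cd_enDens hψ hQ hu) t
  have hval : ∫ x in cube (n+1) Λ, tpd (enDens L θ κ ψ Q u) (x, t)
      = -Γ * (∫ x in cube (n+1) Λ,
            ((molecularField L θ κ gradψ Q (x, t))ᵀ
              * molecularField L θ κ gradψ Q (x, t)).trace)
          - ν * ∫ x in cube (n+1) Λ, ∑ i : Fin (n+1), ∑ j : Fin (n+1), (spd j u (x, t) i) ^ 2 := by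
    simp only [hpt, ← ip_eq_trace]
    have hs : Continuous fun x : Fin (n+1) → ℝ =>
        -Γ * ip (molecularField L θ κ gradψ Q (x, t)) (molecularField L θ κ gradψ Q (x, t))
        - ν * ∑ i : Fin (n+1), ∑ j : Fin (n+1), (spd j u (x, t) i) ^ 2 :=
      (hcH.const_mul _).sub (hcu.const_mul _)
    rw [integral_add (hI hs) (hI hcd),
      integral_sub (hI (hcH.const_mul _)) (hI (hcu.const_mul _)), integral_const_mul,
      integral_const_mul, hz, add_zero]
  rw [hval] at hmain
  refine hmain.congr_of_eventuallyEq (Filter.Eventually.of_forall fun s => ?_)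
  dsimp only
  congr 1
  funext x
  simp only [enDens, ip_eq_trace, hQsym, pow_two]
end
end
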